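/- (Proposition 2, hyperbolic potential.) Let K, N be positive integers, L ∈ ℝ^{K×(N+1)}, η ≥ 0, ε > 0, λ ≥ 0, δ > 0, and take φ(w) = λ√(w² + δ²) with ψ(w) = λ/√(w² + δ²). Define A(θ') = 2LᵀL + Diag(ψ(θ'_1) + η, …, ψ(θ'_N) + η, ε) ∈ ℝ^{(N+1)×(N+1)}. Then for all θ, θ' ∈ ℝ^{N+1}: Φ(θ) ≤ Φ(θ') + ⟨∇Φ(θ'), θ − θ'⟩ + (1/2)·(θ − θ')ᵀ A(θ') (θ − θ'), with equality when θ = θ'. -/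

import Mathlib

open scoped RealInnerProductSpace Matrix

lemma sq_hinge_le (u v : ℝ) :
    (max (1 - v) 0) ^ 2 ≤ (max (1 - u) 0) ^ 2 + -2 * max (1 - u) 0 * (v - u) + (v - u) ^ 2 := by
  rcases max_cases (1 - v) 0 with ⟨h, _⟩ | ⟨h, _⟩ <;>
  rcases max_cases (1 - u) 0 with ⟨h', _⟩ | ⟨h', _⟩ <;> rw [h, h'] <;>
  nlinarith [sq_nonneg (1 - v)]

lemma le_sq_hinge (u v : ℝ) :
    (max (1 - u) 0) ^ 2 + -2 * max (1 - u) 0 * (v - u) ≤ (max (1 - v) 0) ^ 2 := by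
  rcases max_cases (1 - v) 0 with ⟨h, _⟩ | ⟨h, _⟩ <;>
  rcases max_cases (1 - u) 0 with ⟨h', _⟩ | ⟨h', _⟩ <;> rw [h, h'] <;>
  nlinarith [sq_nonneg (v - u)]

lemma hasDerivAt_sq_hinge (u : ℝ) :
    HasDerivAt (fun v : ℝ => (max (1 - v) 0) ^ 2) (-2 * max (1 - u) 0) u := by
  refine HasDerivAt.of_isLittleO (Asymptotics.IsBigO.trans_isLittleO
    (g := fun v : ℝ => (v - u) ^ 2) ?_ ?_)
  · refine Asymptotics.IsBigO.of_bound 1 (Filter.Eventually.of_forall fun v => ?_)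
    rw [Real.norm_eq_abs, Real.norm_eq_abs, abs_sq, abs_le, smul_eq_mul]
    constructor <;> nlinarith [sq_hinge_le u v, le_sq_hinge u v, sq_nonneg (v - u)]
  · simpa using Asymptotics.isLittleO_pow_sub_sub u one_lt_two

lemma hasDerivAt_sqrt_sq_add_sq {δ : ℝ} (hδ : 0 < δ) (u : ℝ) :
    HasDerivAt (fun w : ℝ => Real.sqrt (w ^ 2 + δ ^ 2)) (u / Real.sqrt (u ^ 2 + δ ^ 2)) u := by
  have h := ((hasDerivAt_pow 2 u).add_const (δ ^ 2)).sqrt (by positivity)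
  convert h using 1
  field_simp
  norm_num [mul_comm]

lemma sqrt_sq_add_sq_le {δ : ℝ} (hδ : 0 < δ) (u v : ℝ) :
    Real.sqrt (v ^ 2 + δ ^ 2) ≤ Real.sqrt (u ^ 2 + δ ^ 2) +
      u / Real.sqrt (u ^ 2 + δ ^ 2) * (v - u) +
      1 / 2 * (1 / Real.sqrt (u ^ 2 + δ ^ 2)) * (v - u) ^ 2 := by
  have ha : 0 < Real.sqrt (u ^ 2 + δ ^ 2) := Real.sqrt_pos.2 (by positivity)
  have ha2 : Real.sqrt (u ^ 2 + δ ^ 2) ^ 2 = u ^ 2 + δ ^ 2 := Real.sq_sqrt (by positivity)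
  have hb2 : Real.sqrt (v ^ 2 + δ ^ 2) ^ 2 = v ^ 2 + δ ^ 2 := Real.sq_sqrt (by positivity)
  set a := Real.sqrt (u ^ 2 + δ ^ 2)
  set b := Real.sqrt (v ^ 2 + δ ^ 2)
  have h : a + u / a * (v - u) + 1 / 2 * (1 / a) * (v - u) ^ 2 - b = (a - b) ^ 2 / (2 * a) := by
    field_simp
    linarith
  have : 0 ≤ (a - b) ^ 2 / (2 * a) := by positivity
  linarith

/-- The linear functional `θ ↦ (Lθ)_k`. -/
noncomputable def mulVecCoord {m n : Type*} [Fintype n] (L : Matrix m n ℝ) (k : m) :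
    EuclideanSpace ℝ n →L[ℝ] ℝ :=
  ∑ j, L k j • EuclideanSpace.proj j

lemma mulVecCoord_apply {m n : Type*} [Fintype n] (L : Matrix m n ℝ) (k : m)
    (θ : EuclideanSpace ℝ n) : mulVecCoord L k θ = L.mulVec θ k := by
  simp [mulVecCoord, Matrix.mulVec, dotProduct]

lemma dotProduct_gram_add_diagonal_mulVec {m : Type*} [Fintype m] {N : ℕ}
    (L : Matrix m (Fin (N + 1)) ℝ) (p : Fin (N + 1) → ℝ) (d : Fin (N + 1) → ℝ) :
    d ⬝ᵥ ((2 : ℝ) • (Lᵀ * L) + Matrix.diagonal p).mulVec d =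
      2 * ∑ k, (L.mulVec d k) ^ 2 +
        (∑ i : Fin N, p i.castSucc * d i.castSucc ^ 2 + p (Fin.last N) * d (Fin.last N) ^ 2) := by
  rw [Matrix.add_mulVec, Matrix.smul_mulVec, dotProduct_add, dotProduct_smul,
    ← Matrix.mulVec_mulVec, Matrix.dotProduct_mulVec, Matrix.vecMul_transpose, smul_eq_mul]
  congr 1
  · simp [dotProduct, sq]
  · simp only [dotProduct, Matrix.mulVec_diagonal, Fin.sum_univ_castSucc]
    congr 1
    · exact Finset.sum_congr rfl fun i _ => by ring
    · ring

/-- (Proposition 2, hyperbolic potential.) The half-quadratic construction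
`h(θ; θ') = Φ(θ') + ⟪∇Φ(θ'), θ − θ'⟫ + ½ (θ − θ')ᵀ A(θ') (θ − θ')`, with
`A(θ') = 2LᵀL + Diag(ψ(θ'₁) + η, …, ψ(θ'_N) + η, ε)` and `ψ(w) = λ/√(w² + δ²)`,
is a tangent majorant of the SVM objective `Φ` at every `θ'`. -/
theorem svm_half_quadratic_majorant_hyperbolic
    (K N : ℕ) (hK : 0 < K) (hN : 0 < N) (L : Matrix (Fin K) (Fin (N + 1)) ℝ)
    (η ε lam δ : ℝ) (hη : 0 ≤ η) (hε : 0 < ε) (hlam : 0 ≤ lam) (hδ : 0 < δ)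
    (φ ψ : ℝ → ℝ)
    (hφ : ∀ w, φ w = lam * Real.sqrt (w ^ 2 + δ ^ 2))
    (hψ : ∀ w, ψ w = lam / Real.sqrt (w ^ 2 + δ ^ 2))
    (Φ : EuclideanSpace ℝ (Fin (N + 1)) → ℝ)
    (hΦ : ∀ θ, Φ θ = ∑ k : Fin K, (max (1 - L.mulVec θ k) 0) ^ 2 +
      (∑ i : Fin N, φ (θ i.castSucc) + η / 2 * ∑ i : Fin N, θ i.castSucc ^ 2))
    (A : EuclideanSpace ℝ (Fin (N + 1)) → Matrix (Fin (N + 1)) (Fin (N + 1)) ℝ)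
    (hA : ∀ θ', A θ' = (2 : ℝ) • (Lᵀ * L) +
      Matrix.diagonal (fun i : Fin (N + 1) =>
        if (i : ℕ) < N then ψ (θ' i) + η else ε)) :
    ∀ θ θ' : EuclideanSpace ℝ (Fin (N + 1)),
      (Φ θ ≤ Φ θ' + ⟪gradient Φ θ', θ - θ'⟫ +
        1 / 2 * ((θ - θ') ⬝ᵥ (A θ').mulVec (θ - θ'))) ∧
      (θ = θ' → Φ θ' + ⟪gradient Φ θ', θ - θ'⟫ +
        1 / 2 * ((θ - θ') ⬝ᵥ (A θ').mulVec (θ - θ')) = Φ θ) := by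
  intro θ θ'
  refine ⟨?_, fun h => by simp [h]⟩
  let P (j : Fin (N + 1)) : EuclideanSpace ℝ (Fin (N + 1)) →L[ℝ] ℝ := EuclideanSpace.proj j
  have hder : HasFDerivAt Φ
      (∑ k : Fin K, (-2 * max (1 - L.mulVec θ' k) 0) • mulVecCoord L k +
        (∑ i : Fin N, (lam * (θ' i.castSucc / Real.sqrt (θ' i.castSucc ^ 2 + δ ^ 2))) • P i.castSucc +
          (η / 2) • ∑ i : Fin N, (2 * θ' i.castSucc) •
            P i.castSucc)) θ' := by
    rw [funext hΦ]
    refine .add (.fun_sum fun k _ => ?_)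
      (.add (.fun_sum fun i _ => ?_) (.const_mul (.fun_sum fun i _ => ?_) _))
    · simp only [← mulVecCoord_apply]
      exact (hasDerivAt_sq_hinge _).comp_hasFDerivAt θ' (mulVecCoord L k).hasFDerivAt
    · simp only [hφ]
      exact ((hasDerivAt_sqrt_sq_add_sq hδ _).const_mul lam).comp_hasFDerivAt θ'
        (P i.castSucc).hasFDerivAt
    · have h := (hasDerivAt_pow 2 (P i.castSucc θ')).comp_hasFDerivAt θ'
        (P i.castSucc).hasFDerivAt
      simp only [Nat.cast_ofNat, Nat.add_one_sub_one, pow_one] at h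
      exact h
  have hgrad : ⟪gradient Φ θ', θ - θ'⟫ =
      ∑ k : Fin K, -2 * max (1 - L.mulVec θ' k) 0 * (L.mulVec θ k - L.mulVec θ' k) +
        (∑ i : Fin N, lam * (θ' i.castSucc / Real.sqrt (θ' i.castSucc ^ 2 + δ ^ 2)) *
            (θ i.castSucc - θ' i.castSucc) +
          η / 2 * ∑ i : Fin N, 2 * θ' i.castSucc * (θ i.castSucc - θ' i.castSucc)) := by
    rw [gradient, InnerProductSpace.toDual_symm_apply, hder.fderiv]
    simp [P, mulVecCoord_apply, Matrix.mulVec_sub]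
  have hquad : 1 / 2 * ((θ - θ') ⬝ᵥ (A θ').mulVec (θ - θ')) =
      ∑ k : Fin K, (L.mulVec θ k - L.mulVec θ' k) ^ 2 +
        (∑ i : Fin N, 1 / 2 * (ψ (θ' i.castSucc) + η) * (θ i.castSucc - θ' i.castSucc) ^ 2 +
          1 / 2 * ε * (θ (Fin.last N) - θ' (Fin.last N)) ^ 2) := by
    rw [hA, WithLp.ofLp_sub, dotProduct_gram_add_diagonal_mulVec]
    simp only [mul_add (1 / 2 : ℝ) (_ * _), mul_add (1 / 2 : ℝ) (Finset.sum _ _)]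
    simp [Matrix.mulVec_sub, Finset.mul_sum, mul_assoc]
  have hhinge := Finset.sum_le_sum fun k (_ : k ∈ Finset.univ) =>
    sq_hinge_le (L.mulVec θ' k) (L.mulVec θ k)
  have hreg : ∑ i : Fin N, (φ (θ i.castSucc) + η / 2 * θ i.castSucc ^ 2) ≤
      ∑ i : Fin N, (φ (θ' i.castSucc) + η / 2 * θ' i.castSucc ^ 2 +
        lam * (θ' i.castSucc / Real.sqrt (θ' i.castSucc ^ 2 + δ ^ 2)) *
            (θ i.castSucc - θ' i.castSucc) +
        η / 2 * (2 * θ' i.castSucc * (θ i.castSucc - θ' i.castSucc)) +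
        1 / 2 * (ψ (θ' i.castSucc) + η) * (θ i.castSucc - θ' i.castSucc) ^ 2) := by
    refine Finset.sum_le_sum fun i _ => ?_
    rw [hφ, hφ, hψ, div_eq_mul_one_div lam]
    linarith [mul_le_mul_of_nonneg_left
      (sqrt_sq_add_sq_le hδ (θ' i.castSucc) (θ i.castSucc)) hlam]
  have hlast : 0 ≤ 1 / 2 * ε * (θ (Fin.last N) - θ' (Fin.last N)) ^ 2 := by positivity
  rw [hgrad, hquad, hΦ, hΦ]
  simp only [Finset.sum_add_distrib, ← Finset.mul_sum] at hhinge hreg ⊢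
  linarith
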